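/- Let p₁, …, p_t be primes and f₁, …, f_t, r₁, …, r_t positive integers with p_i^{f_i} ≠ p_j^{f_j} for i ≠ j. Let A₁ and A₂ be abelian groups, each isomorphic to (Z_{p₁^{f₁}})^{r₁} × ⋯ × (Z_{p_t^{f_t}})^{r_t}, and let V = GL(r₁, Z_{p₁}) × ⋯ × GL(r_t, Z_{p_t}). Then there exist group homomorphisms Φ₁ : Aut(A₁) → V and Φ₂ : Aut(A₂) → V such that for all automorphisms ζ₁ ∈ Aut(A₁) and ζ₂ ∈ Aut(A₂) whose orders are coprime with |A₁|, the following are equivalent: (i) there exists a group isomorphism χ : A₁ → A₂ with ζ₁ = χ⁻¹ ∘ ζ₂ ∘ χ; (ii) there exists X ∈ V with Φ₁(ζ₁) = X⁻¹ · Φ₂(ζ₂) · X. -/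

import Mathlib

/-- If `ρ : R →+* S` is a surjective local homomorphism and `n` is invertible in `S`, then units of
`R` killed by `n` are conjugate as soon as their images are: average a lift of a conjugator. -/
theorem exists_units_conj_of_map_conj {R S : Type*} [Ring R] [Ring S] (ρ : R →+* S)
    [IsLocalHom ρ] (hρ : Function.Surjective ρ) {n : ℕ} (hn : IsUnit (n : S)) {u v : Rˣ}
    (hu : u ^ n = 1) (hv : v ^ n = 1) (X : Sˣ)
    (h : Units.map (ρ : R →* S) u = X⁻¹ * Units.map (ρ : R →* S) v * X) :
    ∃ w : Rˣ, v * w = w * u := by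
  obtain ⟨x, hx⟩ := hρ X
  set g : ℕ → R := fun k => ((v ^ k : Rˣ) : R) * x * ((u⁻¹ ^ k : Rˣ) : R) with hg
  have hg_map (k : ℕ) : ρ (g k) = X := by
    have hX : X = (Units.map (ρ : R →* S) v) ^ k * X * (Units.map (ρ : R →* S) u)⁻¹ ^ k := by
      have : Units.map (ρ : R →* S) u = X⁻¹ * Units.map (ρ : R →* S) v * (X⁻¹)⁻¹ := by
        rw [h, inv_inv]
      rw [inv_pow, this, conj_pow]
      group
    rw [← map_inv, ← map_pow, ← map_pow] at hX
    have hX' := congrArg Units.val hX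
    simp only [Units.val_mul, Units.coe_map, MonoidHom.coe_coe] at hX'
    rw [hg, map_mul, map_mul, hx, ← hX']
  have hg_succ (k : ℕ) : (v : R) * g k = g (k + 1) * u := by
    simp only [hg, pow_succ' v, pow_succ u⁻¹, Units.val_mul, mul_assoc, Units.inv_mul, mul_one]
  have hsum : (v : R) * ∑ k ∈ Finset.range n, g k = (∑ k ∈ Finset.range n, g k) * u := by
    have hshift : ∑ k ∈ Finset.range n, g (k + 1) = ∑ k ∈ Finset.range n, g k := by
      have h₁ := Finset.sum_range_succ g n
      have h₂ := Finset.sum_range_succ' g n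
      have h₃ : g n = g 0 := by simp only [hg, inv_pow, hu, hv, pow_zero]
      rw [h₁, h₃] at h₂
      exact (add_right_cancel h₂).symm
    rw [Finset.mul_sum, ← hshift, Finset.sum_mul]
    exact Finset.sum_congr rfl fun k _ => hg_succ k
  have hunit : IsUnit (∑ k ∈ Finset.range n, g k) := by
    refine isUnit_of_map_unit ρ _ ?_
    rw [map_sum, Finset.sum_congr rfl fun k _ => hg_map k, Finset.sum_const, Finset.card_range,
      nsmul_eq_mul]
    exact hn.mul X.isUnit
  obtain ⟨w, hw⟩ := hunit
  exact ⟨w, Units.ext (by simpa [hw] using hsum)⟩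

theorem ZMod.eq_zero_of_pow_nsmul_eq_zero {p q e k : ℕ} (hp : p.Prime) (hq : q.Prime)
    (hpq : p ≠ q) {x : ZMod (q ^ e)} (hx : p ^ k • x = 0) : x = 0 := by
  rw [nsmul_eq_mul] at hx
  refine (IsUnit.mul_right_eq_zero ?_).mp hx
  rw [ZMod.isUnit_iff_coprime]
  exact Nat.Coprime.pow _ _ ((Nat.coprime_primes hp hq).mpr hpq)

theorem ZMod.exists_pow_nsmul_eq_pow_succ_nsmul {p q e h : ℕ} (hp : p.Prime) (hq : q.Prime)
    (hne : q ^ e ≠ p ^ (h + 1)) {x : ZMod (q ^ e)} (hx : p ^ (h + 1) • x = 0) :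
    ∃ z : ZMod (q ^ e), p ^ h • x = p ^ (h + 1) • z := by
  have : NeZero (q ^ e) := ⟨pow_ne_zero _ hq.ne_zero⟩
  by_cases hpq : p = q
  · subst hpq
    rcases lt_trichotomy e (h + 1) with he | rfl | he
    · refine ⟨0, ?_⟩
      rw [nsmul_eq_mul, (ZMod.natCast_eq_zero_iff _ _).mpr (pow_dvd_pow p (Nat.lt_succ_iff.mp he))]
      simp
    · exact absurd rfl hne
    · obtain ⟨n, rfl⟩ := ZMod.natCast_zmod_surjective x
      rw [nsmul_eq_mul, ← Nat.cast_mul, ZMod.natCast_eq_zero_iff] at hx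
      have hdvd : p ∣ n := by
        have : p ^ (h + 1) * p ∣ p ^ (h + 1) * n := by
          rw [← pow_succ]
          exact (pow_dvd_pow p he).trans hx
        exact Nat.dvd_of_mul_dvd_mul_left (pow_pos hp.pos _) this
      obtain ⟨m, rfl⟩ := hdvd
      refine ⟨m, ?_⟩
      simp only [nsmul_eq_mul]
      push_cast
      ring
  · exact ⟨0, by rw [ZMod.eq_zero_of_pow_nsmul_eq_zero hp hq hpq hx]; simp⟩

theorem ZMod.castHom_eq_zero_iff_pow_nsmul {p f : ℕ} (hp : p.Prime) (hf : 0 < f)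
    (hd : p ∣ p ^ f) (x : ZMod (p ^ f)) :
    ZMod.castHom hd (ZMod p) x = 0 ↔ p ^ (f - 1) • x = 0 := by
  have : NeZero (p ^ f) := ⟨pow_ne_zero _ hp.ne_zero⟩
  obtain ⟨n, rfl⟩ := ZMod.natCast_zmod_surjective x
  obtain ⟨k, rfl⟩ : ∃ k, f = k + 1 := ⟨f - 1, by omega⟩
  rw [map_natCast, ZMod.natCast_eq_zero_iff, nsmul_eq_mul, ← Nat.cast_mul,
    ZMod.natCast_eq_zero_iff, Nat.add_sub_cancel, pow_succ]
  exact (Nat.mul_dvd_mul_iff_left (pow_pos hp.pos _)).symm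

/-- Automorphisms of `A` as units of the endomorphism ring of an additive copy of `A`. -/
def mulAutToEndUnits {A M : Type*} [CommGroup A] [AddCommGroup M] (e : Additive A ≃+ M) :
    MulAut A →* (AddMonoid.End M)ˣ :=
  MonoidHom.toHomUnits
    { toFun := fun ζ => (e.toAddMonoidHom.comp
        ((MulEquiv.toAdditive ζ).toAddMonoidHom.comp e.symm.toAddMonoidHom) : M →+ M)
      map_one' := by
        ext1 x
        exact e.apply_symm_apply x
      map_mul' := fun ζ η => by
        ext1 x
        change e (Additive.ofMul (ζ (η (e.symm x).toMul))) =
          e (Additive.ofMul (ζ (e.symm (e (Additive.ofMul (η (e.symm x).toMul)))).toMul))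
        rw [e.symm_apply_apply]
        rfl }

/-- Conjugacy of automorphisms through an isomorphism is conjugacy in the endomorphism ring. -/
theorem exists_mulEquiv_conj_iff {A₁ A₂ M : Type*} [CommGroup A₁] [CommGroup A₂] [AddCommGroup M]
    (e₁ : Additive A₁ ≃+ M) (e₂ : Additive A₂ ≃+ M) (ζ₁ : MulAut A₁) (ζ₂ : MulAut A₂) :
    (∃ χ : A₁ ≃* A₂, ∀ a, ζ₁ a = χ.symm (ζ₂ (χ a))) ↔
      ∃ w : (AddMonoid.End M)ˣ, mulAutToEndUnits e₂ ζ₂ * w = w * mulAutToEndUnits e₁ ζ₁ := by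
  constructor
  · rintro ⟨χ, hχ⟩
    let g : M ≃+ M := e₁.symm.trans ((MulEquiv.toAdditive χ).trans e₂)
    refine ⟨⟨g.toAddMonoidHom, g.symm.toAddMonoidHom, ?_, ?_⟩, ?_⟩
    · ext1 x
      exact g.apply_symm_apply x
    · ext1 x
      exact g.symm_apply_apply x
    · ext1
      ext1 x
      change e₂ (Additive.ofMul (ζ₂ (e₂.symm (e₂ (Additive.ofMul (χ (e₁.symm x).toMul)))).toMul)) =
        e₂ (Additive.ofMul (χ (e₁.symm (e₁ (Additive.ofMul (ζ₁ (e₁.symm x).toMul)))).toMul))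
      rw [e₁.symm_apply_apply, e₂.symm_apply_apply, toMul_ofMul, toMul_ofMul, hχ,
        χ.apply_symm_apply]
  · rintro ⟨w, hw⟩
    let g : M ≃+ M :=
      { toFun := (w : AddMonoid.End M)
        invFun := ((w⁻¹ : (AddMonoid.End M)ˣ) : AddMonoid.End M)
        left_inv := fun x => DFunLike.congr_fun (w.inv_mul) x
        right_inv := fun x => DFunLike.congr_fun (w.mul_inv) x
        map_add' := map_add _ }
    let χ : A₁ ≃* A₂ := MulEquiv.toAdditive.symm (e₁.trans (g.trans e₂.symm))
    refine ⟨χ, fun a => ?_⟩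
    rw [MulEquiv.eq_symm_apply]
    have h := DFunLike.congr_fun (congrArg Units.val hw) (e₁ (Additive.ofMul a))
    change e₂ (Additive.ofMul (ζ₂ (χ a))) =
      g (e₁ (Additive.ofMul (ζ₁ (e₁.symm (e₁ (Additive.ofMul a))).toMul))) at h
    rw [e₁.symm_apply_apply, toMul_ofMul] at h
    change (e₂.symm (g (e₁ (Additive.ofMul (ζ₁ a))))).toMul = _
    rw [← h, e₂.symm_apply_apply, toMul_ofMul]

section HomocyclicProduct

variable {ι : Type*} {p f r : ι → ℕ}

/-- The product `∏ i, (ℤ / p i ^ f i) ^ r i`, written additively. -/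
abbrev HomocyclicProd (p f r : ι → ℕ) : Type _ := ∀ i : ι, Fin (r i) → ZMod (p i ^ f i)

/-- The additive form of a multiplicative isomorphism onto `∏ i, (ℤ / p i ^ f i) ^ r i`. -/
def toHomocyclicProd {A : Type*} [CommGroup A]
    (e : A ≃* (∀ i : ι, Fin (r i) → Multiplicative (ZMod (p i ^ f i)))) :
    Additive A ≃+ HomocyclicProd p f r where
  toFun a i b := (e a.toMul i b).toAdd
  invFun x := Additive.ofMul (e.symm fun i b => Multiplicative.ofAdd (x i b))
  left_inv a := e.symm_apply_apply a.toMul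
  right_inv x := by
    funext i b
    simp
  map_add' a b := by
    funext i c
    simp

theorem dvd_natCard_homocyclicProd [Fintype ι] (hf : ∀ i, 0 < f i) (hr : ∀ i, 0 < r i) (i : ι) :
    p i ∣ Nat.card (HomocyclicProd p f r) := by
  rw [Nat.card_pi]
  refine dvd_trans ?_ (Finset.dvd_prod_of_mem _ (Finset.mem_univ i))
  rw [Nat.card_pi]
  refine dvd_trans ?_ (Finset.dvd_prod_of_mem _ (Finset.mem_univ (⟨0, hr i⟩ : Fin (r i))))
  rw [Nat.card_zmod]
  exact dvd_pow_self _ (hf i).ne'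

variable [DecidableEq ι]

/-- The diagonal block at `i` of an endomorphism, reduced modulo `p i`. -/
def diagBlock (hf : ∀ i, 0 < f i) (T : AddMonoid.End (HomocyclicProd p f r)) (i : ι) :
    Matrix (Fin (r i)) (Fin (r i)) (ZMod (p i)) :=
  fun a b => ZMod.castHom (dvd_pow_self (p i) (hf i).ne') (ZMod (p i))
    (T (Pi.single i (Pi.single b 1)) i a)

theorem castHom_apply_eq_zero (hp : ∀ i, (p i).Prime) (hf : ∀ i, 0 < f i)
    (hdist : ∀ i j, i ≠ j → p i ^ f i ≠ p j ^ f j) (T : AddMonoid.End (HomocyclicProd p f r))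
    {i : ι} {z : HomocyclicProd p f r} (hz : p i ^ f i • z = 0) (hzi : z i = 0) (a : Fin (r i)) :
    ZMod.castHom (dvd_pow_self (p i) (hf i).ne') (ZMod (p i)) (T z i a) = 0 := by
  have hfi : f i - 1 + 1 = f i := Nat.sub_add_cancel (hf i)
  have hw (k : ι) (b : Fin (r k)) :
      ∃ w : ZMod (p k ^ f k), p i ^ (f i - 1) • z k b = p i ^ f i • w := by
    by_cases hk : k = i
    · subst hk
      exact ⟨0, by simp [hzi]⟩
    · have hne : p k ^ f k ≠ p i ^ (f i - 1 + 1) := by rw [hfi]; exact hdist k i hk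
      have hzk : p i ^ (f i - 1 + 1) • z k b = 0 := by
        rw [hfi]; exact congrFun (congrFun hz k) b
      simpa only [hfi] using ZMod.exists_pow_nsmul_eq_pow_succ_nsmul (hp i) (hp k) hne hzk
  choose w hw using hw
  have hzw : p i ^ (f i - 1) • z = p i ^ f i • (w : HomocyclicProd p f r) := by
    funext k b
    exact hw k b
  rw [ZMod.castHom_eq_zero_iff_pow_nsmul (hp i) (hf i)]
  have hT := congrFun (congrFun (congrArg T hzw) i) a
  rw [map_nsmul, map_nsmul] at hT
  simpa using hT

theorem castHom_apply_eq_sum_diagBlock (hp : ∀ i, (p i).Prime) (hf : ∀ i, 0 < f i)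
    (hdist : ∀ i j, i ≠ j → p i ^ f i ≠ p j ^ f j) (T : AddMonoid.End (HomocyclicProd p f r))
    {i : ι} {z : HomocyclicProd p f r} (hz : p i ^ f i • z = 0) (a : Fin (r i)) :
    ZMod.castHom (dvd_pow_self (p i) (hf i).ne') (ZMod (p i)) (T z i a) =
      ∑ b, diagBlock hf T i a b *
        ZMod.castHom (dvd_pow_self (p i) (hf i).ne') (ZMod (p i)) (z i b) := by
  have : NeZero (p i ^ f i) := ⟨pow_ne_zero _ (hp i).ne_zero⟩
  have hdecomp : (Pi.single i (z i) : HomocyclicProd p f r) =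
      ∑ b, (z i b).val • (Pi.single i (Pi.single b 1) : HomocyclicProd p f r) := by
    funext k c
    by_cases hk : k = i
    · subst hk
      simp [-nsmul_eq_mul, Finset.sum_apply, Pi.smul_apply, Pi.single_apply]
    · simp [Finset.sum_apply, hk]
  have hrest : p i ^ f i • (z - Pi.single i (z i)) = 0 := by
    rw [smul_sub, hz, zero_sub, neg_eq_zero, ← Pi.single_smul]
    have : p i ^ f i • z i = 0 := congrFun hz i
    rw [this, Pi.single_zero]
  have h₀ := castHom_apply_eq_zero hp hf hdist T hrest (by simp) a
  rw [map_sub, Pi.sub_apply, Pi.sub_apply, map_sub, sub_eq_zero] at h₀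
  rw [h₀, hdecomp, map_sum, Finset.sum_apply, Finset.sum_apply, map_sum]
  refine Finset.sum_congr rfl fun b _ => ?_
  rw [map_nsmul, Pi.smul_apply, Pi.smul_apply, map_nsmul, nsmul_eq_mul, mul_comm, diagBlock]
  congr 1
  conv_rhs => rw [← ZMod.natCast_zmod_val (z i b), map_natCast]

/-- Reducing the diagonal blocks of an endomorphism of `∏ i, (ℤ / p i ^ f i) ^ r i` modulo the
primes is a ring homomorphism when the prime powers are distinct. -/
def diagBlockHom (hp : ∀ i, (p i).Prime) (hf : ∀ i, 0 < f i)
    (hdist : ∀ i j, i ≠ j → p i ^ f i ≠ p j ^ f j) :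
    AddMonoid.End (HomocyclicProd p f r) →+*
      ∀ i : ι, Matrix (Fin (r i)) (Fin (r i)) (ZMod (p i)) where
  toFun T := diagBlock hf T
  map_one' := by
    funext i
    ext a b
    simp only [diagBlock, AddMonoid.End.coe_one, id, Pi.single_eq_same, Pi.one_apply,
      Matrix.one_apply, Pi.single_apply]
    split_ifs
    · exact map_one _
    · exact map_zero _
  map_mul' S T := by
    funext i
    ext a b
    have hz : p i ^ f i • T (Pi.single i (Pi.single b 1)) = 0 := by
      rw [← map_nsmul, ← Pi.single_smul, ← Pi.single_smul]
      simp
    exact castHom_apply_eq_sum_diagBlock hp hf hdist S hz a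
  map_zero' := by
    funext i
    ext a b
    simp [diagBlock]
  map_add' S T := by
    funext i
    ext a b
    exact map_add _ _ _

theorem diagBlockHom_surjective (hp : ∀ i, (p i).Prime) (hf : ∀ i, 0 < f i)
    (hdist : ∀ i j, i ≠ j → p i ^ f i ≠ p j ^ f j) :
    Function.Surjective (diagBlockHom (r := r) hp hf hdist) := by
  intro X
  have (i : ι) : NeZero (p i) := ⟨(hp i).ne_zero⟩
  let T : AddMonoid.End (HomocyclicProd p f r) :=
    { toFun := fun x i => ((X i).map fun y => ((y.val : ℕ) : ZMod (p i ^ f i))).mulVec (x i)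
      map_zero' := by funext i; simp
      map_add' := fun x y => by funext i; simp [Matrix.mulVec_add] }
  refine ⟨T, ?_⟩
  funext i
  ext a b
  change ZMod.castHom (dvd_pow_self (p i) (hf i).ne') (ZMod (p i))
    (((X i).map fun y => ((y.val : ℕ) : ZMod (p i ^ f i))).mulVec
      ((Pi.single i (Pi.single b 1) : HomocyclicProd p f r) i) a) = X i a b
  rw [Pi.single_eq_same, Matrix.mulVec_single_one, Matrix.col_apply, Matrix.map_apply,
    map_natCast, ZMod.natCast_zmod_val]

/-- An element of order dividing `q` in the kernel of an endomorphism with invertible reduced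
diagonal blocks is divisible by all powers of `q`. -/
theorem exists_eq_pow_nsmul_of_apply_eq_zero (hp : ∀ i, (p i).Prime) (hf : ∀ i, 0 < f i)
    (hdist : ∀ i j, i ≠ j → p i ^ f i ≠ p j ^ f j) {T : AddMonoid.End (HomocyclicProd p f r)}
    (hT : ∀ i, IsUnit (diagBlock hf T i)) {q : ℕ} (hq : q.Prime) {x : HomocyclicProd p f r}
    (hx : q • x = 0) (hTx : T x = 0) (h : ℕ) : ∃ z, x = q ^ h • z := by
  induction h with
  | zero => exact ⟨x, by simp⟩
  | succ h ih =>
    obtain ⟨z, rfl⟩ := ih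
    have hz : q ^ (h + 1) • z = 0 := by rw [pow_succ', mul_smul, hx]
    have hw (k : ι) (b : Fin (r k)) : ∃ w, q ^ h • z k b = q ^ (h + 1) • w := by
      by_cases hk : p k ^ f k = q ^ (h + 1)
      · obtain ⟨hpk, hfk'⟩ : p k = q ∧ f k - 1 = h := by
          refine (hp k).pow_inj hq ?_
          rwa [Nat.sub_add_cancel (hf k)]
        subst hpk
        have hvec : (diagBlock hf T k).mulVec (fun c =>
            ZMod.castHom (dvd_pow_self (p k) (hf k).ne') (ZMod (p k)) (z k c)) = 0 := by
          funext a
          refine (castHom_apply_eq_sum_diagBlock hp hf hdist T (by rw [hk]; exact hz) a).symm.trans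
            ((ZMod.castHom_eq_zero_iff_pow_nsmul (hp k) (hf k) _ _).mpr ?_)
          rw [hfk']
          rw [map_nsmul] at hTx
          exact congrFun (congrFun hTx k) a
        have hzero := congrFun (Matrix.mulVec_injective_of_isUnit (hT k)
          (hvec.trans (Matrix.mulVec_zero _).symm)) b
        refine ⟨0, ?_⟩
        have := (ZMod.castHom_eq_zero_iff_pow_nsmul (hp k) (hf k) _ _).mp hzero
        rw [hfk'] at this
        rw [this, smul_zero]
      · exact ZMod.exists_pow_nsmul_eq_pow_succ_nsmul hq (hp k) hk (congrFun (congrFun hz k) b)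
    choose w hw using hw
    exact ⟨w, by funext k b; exact hw k b⟩

theorem isLocalHom_diagBlockHom [Fintype ι] (hp : ∀ i, (p i).Prime) (hf : ∀ i, 0 < f i)
    (hdist : ∀ i j, i ≠ j → p i ^ f i ≠ p j ^ f j) :
    IsLocalHom (diagBlockHom (r := r) hp hf hdist) := by
  refine ⟨fun T hT => ?_⟩
  have hT' : ∀ i, IsUnit (diagBlock hf T i) := Pi.isUnit_iff.mp hT
  have (i : ι) : NeZero (p i ^ f i) := ⟨pow_ne_zero _ (hp i).ne_zero⟩
  have hprime {q : ℕ} (hq : q.Prime) {x : HomocyclicProd p f r} (hx : q • x = 0)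
      (hTx : T x = 0) : x = 0 := by
    obtain ⟨z, rfl⟩ := exists_eq_pow_nsmul_of_apply_eq_zero hp hf hdist hT' hq hx hTx (∑ i, f i)
    funext k b
    by_cases hqk : q = p k
    · have hdvd : p k ^ f k ∣ q ^ ∑ i, f i :=
        hqk ▸ pow_dvd_pow _ (Finset.single_le_sum (fun _ _ => Nat.zero_le _) (Finset.mem_univ k))
      change q ^ (∑ i, f i) • z k b = 0
      rw [nsmul_eq_mul, (ZMod.natCast_eq_zero_iff _ _).mpr hdvd, zero_mul]
    · refine ZMod.eq_zero_of_pow_nsmul_eq_zero (k := 1) hq (hp k) hqk ?_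
      rw [pow_one]
      exact congrFun (congrFun hx k) b
  have hinj : Function.Injective T := by
    rw [injective_iff_map_eq_zero]
    intro x hTx
    by_contra hx
    have hord : addOrderOf x ≠ 1 := by rwa [Ne, AddMonoid.addOrderOf_eq_one_iff]
    obtain ⟨m, hm⟩ := Nat.minFac_dvd (addOrderOf x)
    have hq := Nat.minFac_prime hord
    have hmx : m • x = 0 := by
      refine hprime hq ?_ (by rw [map_nsmul, hTx, smul_zero])
      rw [← mul_smul, ← hm, addOrderOf_nsmul_eq_zero]
    have hpos : 0 < addOrderOf x := addOrderOf_pos x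
    have hm0 : 0 < m := by
      rcases Nat.eq_zero_or_pos m with rfl | h
      · omega
      · exact h
    have hle := Nat.le_of_dvd hm0 (addOrderOf_dvd_of_nsmul_eq_zero hmx)
    have := hq.two_le
    nlinarith
  let e : HomocyclicProd p f r ≃+ HomocyclicProd p f r :=
    AddEquiv.ofBijective T (Finite.injective_iff_bijective.mp hinj)
  refine ⟨⟨T, e.symm.toAddMonoidHom, ?_, ?_⟩, rfl⟩
  · ext1 x
    exact e.apply_symm_apply x
  · ext1 x
    exact e.symm_apply_apply x

end HomocyclicProduct

theorem stmt13 (t : ℕ) (p f r : Fin t → ℕ)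
    (hp : ∀ i, (p i).Prime) (hf : ∀ i, 0 < f i) (hr : ∀ i, 0 < r i)
    (hdist : ∀ i j, i ≠ j → p i ^ f i ≠ p j ^ f j)
    (A₁ A₂ : Type*) [CommGroup A₁] [CommGroup A₂]
    (h₁ : Nonempty (A₁ ≃* (∀ i : Fin t, Fin (r i) → Multiplicative (ZMod (p i ^ f i)))))
    (h₂ : Nonempty (A₂ ≃* (∀ i : Fin t, Fin (r i) → Multiplicative (ZMod (p i ^ f i))))) :
    ∃ (Φ₁ : MulAut A₁ →* (∀ i : Fin t, Matrix.GeneralLinearGroup (Fin (r i)) (ZMod (p i))))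
      (Φ₂ : MulAut A₂ →* (∀ i : Fin t, Matrix.GeneralLinearGroup (Fin (r i)) (ZMod (p i)))),
      ∀ (ζ₁ : MulAut A₁) (ζ₂ : MulAut A₂),
        Nat.Coprime (orderOf ζ₁) (Nat.card A₁) →
        Nat.Coprime (orderOf ζ₂) (Nat.card A₁) →
        ((∃ χ : A₁ ≃* A₂, ∀ a : A₁, ζ₁ a = χ.symm (ζ₂ (χ a))) ↔
          (∃ X : ∀ i : Fin t, Matrix.GeneralLinearGroup (Fin (r i)) (ZMod (p i)),
            Φ₁ ζ₁ = X⁻¹ * Φ₂ ζ₂ * X)) := by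
  obtain ⟨e₁⟩ := h₁
  obtain ⟨e₂⟩ := h₂
  let ε₁ := toHomocyclicProd e₁
  let ε₂ := toHomocyclicProd e₂
  let ρ := diagBlockHom (r := r) hp hf hdist
  have : IsLocalHom ρ := isLocalHom_diagBlockHom hp hf hdist
  let π : (∀ i : Fin t, Matrix (Fin (r i)) (Fin (r i)) (ZMod (p i)))ˣ ≃*
      ∀ i : Fin t, Matrix.GeneralLinearGroup (Fin (r i)) (ZMod (p i)) := MulEquiv.piUnits
  let σ := Units.map (ρ : AddMonoid.End (HomocyclicProd p f r) →*
    ∀ i : Fin t, Matrix (Fin (r i)) (Fin (r i)) (ZMod (p i)))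
  refine ⟨π.toMonoidHom.comp (σ.comp (mulAutToEndUnits ε₁)),
    π.toMonoidHom.comp (σ.comp (mulAutToEndUnits ε₂)), fun ζ₁ ζ₂ hζ₁ hζ₂ => ?_⟩
  rw [exists_mulEquiv_conj_iff ε₁ ε₂]
  constructor
  · rintro ⟨w, hw⟩
    refine ⟨π (σ w), ?_⟩
    change π (σ (mulAutToEndUnits ε₁ ζ₁)) = (π (σ w))⁻¹ * π (σ (mulAutToEndUnits ε₂ ζ₂)) * π (σ w)
    rw [mul_assoc, eq_inv_mul_iff_mul_eq, ← map_mul, ← map_mul, ← map_mul, ← map_mul, hw]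
  · rintro ⟨X, hX⟩
    refine exists_units_conj_of_map_conj ρ (diagBlockHom_surjective hp hf hdist)
      (n := orderOf ζ₁ * orderOf ζ₂) ?_ ?_ ?_ (π.symm X) ?_
    · rw [Pi.isUnit_iff]
      intro i
      have hdvd : p i ∣ Nat.card A₁ := by
        have h := dvd_natCard_homocyclicProd (p := p) hf hr i
        rwa [← Nat.card_congr ε₁.toEquiv] at h
      have hcop : Nat.Coprime (orderOf ζ₁ * orderOf ζ₂) (p i) :=
        (hζ₁.mul_left hζ₂).coprime_dvd_right hdvd
      have hu := ((ZMod.isUnit_iff_coprime _ _).mpr hcop).map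
        (algebraMap (ZMod (p i)) (Matrix (Fin (r i)) (Fin (r i)) (ZMod (p i))))
      rwa [map_natCast] at hu
    · rw [← map_pow, pow_mul, pow_orderOf_eq_one, one_pow, map_one]
    · rw [← map_pow, mul_comm, pow_mul, pow_orderOf_eq_one, one_pow, map_one]
    · apply π.injective
      rw [map_mul, map_mul, map_inv, π.apply_symm_apply]
      exact hX
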